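/- Let f : ℝ^n → ℝ^n be differentiable at a point x* with f(x*) = x*, and suppose B := I_n − J* is a symmetric positive definite matrix with minimum eigenvalue a > 0 and maximum eigenvalue b > a, where J* is the Jacobian matrix of f at x*. Let κ := b/a, fix an integer T ≥ 1, and let ω_k^{ch} (k = 0,…,T−1) be the Chebyshev steps of length T on [a,b]. Define the Chebyshev-PSOR iteration x^{(k+1)} = x^{(k)} + ω_{k mod T}^{ch} (f(x^{(k)}) − x^{(k)}). If the sequence (x^{(k)}) converges to x* and x^{(k)} ≠ x* for all k, then limsup_{ℓ→∞} ‖x^{((ℓ+1)T)} − x*‖₂ / ‖x^{(ℓT)} − x*‖₂ ≤ sech(T · arcosh((κ+1)/(κ−1))). -/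

import Mathlib

/-- The Chebyshev steps (Chebyshev-PSOR factors) of length `T` on `[a, b]`. -/
noncomputable def chebStep (a b : ℝ) (T t : ℕ) : ℝ :=
  ((a + b) / 2 + ((b - a) / 2) * Real.cos ((2 * t + 1) * Real.pi / (2 * T)))⁻¹

/-- The inverse hyperbolic cosine on `[1, ∞)`. -/
noncomputable def arcosh (x : ℝ) : ℝ := Real.log (x + Real.sqrt (x ^ 2 - 1))

open Polynomial.Chebyshev in
theorem eval_T_real_eq_prod (T : ℕ) (z : ℝ) :
    (Polynomial.Chebyshev.T ℝ T).eval z = (Polynomial.Chebyshev.T ℝ T).leadingCoeff *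
      ∏ s ∈ Finset.range T, (z - Real.cos ((2 * s + 1) * Real.pi / (2 * T))) := by
  have hinj : Set.InjOn (fun k : ℕ => Real.cos ((2 * k + 1) * Real.pi / (2 * T)))
      (Finset.range T) :=
    (Finset.range T).nodup_map_iff_injOn.mp (roots_T_real_nodup T)
  have hcard : Multiset.card (Polynomial.Chebyshev.T ℝ T).roots =
      (Polynomial.Chebyshev.T ℝ T).natDegree := by
    rw [roots_T_real, Finset.card_val, Finset.card_image_of_injOn hinj, natDegree_T]
    simp
  conv_lhs => rw [← Polynomial.C_leadingCoeff_mul_prod_multiset_X_sub_C hcard]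
  rw [Polynomial.eval_mul, Polynomial.eval_C, roots_T_real]
  change _ * Polynomial.eval z (∏ y ∈ _, _) = _
  rw [Finset.prod_image hinj, Polynomial.eval_prod]
  simp

/-- The Chebyshev steps contract every eigenvalue in `[a, b]` by the Chebyshev rate. -/
theorem abs_prod_one_sub_chebStep_mul_le {a b : ℝ} (ha : 0 < a) (hab : a < b) (T : ℕ)
    {μ : ℝ} (h₁ : a ≤ μ) (h₂ : μ ≤ b) :
    |∏ s ∈ Finset.range T, (1 - chebStep a b T s * μ)| ≤
      (Real.cosh (T * arcosh ((b / a + 1) / (b / a - 1))))⁻¹ := by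
  have hd : 0 < b - a := sub_pos.mpr hab
  set w : ℝ := (a + b) / (b - a) with hw
  set z : ℝ := (2 * μ - (a + b)) / (b - a) with hz
  have hκ : (b / a + 1) / (b / a - 1) = w := by
    have : b / a - 1 = (b - a) / a := by field_simp
    rw [this, hw]
    field_simp
    ring
  have hw1 : 1 < w := by
    rw [hw, one_lt_div hd]
    linarith
  have hz1 : |z| ≤ 1 := by
    rw [hz, abs_div, abs_of_pos hd, div_le_one hd, abs_le]
    constructor <;> linarith
  have hfac (s : ℕ) : 1 - chebStep a b T s * μ =
      (z - Real.cos ((2 * s + 1) * Real.pi / (2 * T))) /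
        (-w - Real.cos ((2 * s + 1) * Real.pi / (2 * T))) := by
    rw [chebStep, hz, hw]
    have hc := Real.neg_one_le_cos ((2 * s + 1) * Real.pi / (2 * T))
    set c := Real.cos ((2 * s + 1) * Real.pi / (2 * T))
    have h₃ : a + b + (b - a) * c ≠ 0 := by nlinarith
    have h₄ : -((a + b) / (b - a)) - c ≠ 0 := by rw [← hw]; linarith
    rw [eq_div_iff h₄]
    field_simp
    ring
  have hlc : (Polynomial.Chebyshev.T ℝ T).leadingCoeff ≠ 0 :=
    Polynomial.leadingCoeff_ne_zero.mpr (Polynomial.Chebyshev.T_ne_zero ℝ T)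
  have hprod : ∏ s ∈ Finset.range T, (1 - chebStep a b T s * μ) =
      (Polynomial.Chebyshev.T ℝ T).eval z / (Polynomial.Chebyshev.T ℝ T).eval (-w) := by
    rw [eval_T_real_eq_prod, eval_T_real_eq_prod, mul_div_mul_left _ _ hlc,
      ← Finset.prod_div_distrib]
    exact Finset.prod_congr rfl fun s _ => hfac s
  have hcosh : |(Polynomial.Chebyshev.T ℝ T).eval (-w)| = Real.cosh (T * arcosh w) := by
    have h := Polynomial.Chebyshev.T_real_cosh (arcosh w) T
    rw [show Real.cosh (arcosh w) = w from Real.cosh_arcosh hw1.le] at h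
    rw [Polynomial.Chebyshev.T_eval_neg, abs_mul, h]
    simp [(Real.cosh_pos _).le]
  rw [hκ, hprod, abs_div, hcosh, ← one_div]
  exact div_le_div_of_nonneg_right (Polynomial.Chebyshev.abs_eval_T_real_le_one T hz1)
    (Real.cosh_pos _).le

theorem OrthonormalBasis.norm_apply_le_of_forall_eigenvector {ι E : Type*} [Fintype ι]
    [NormedAddCommGroup E] [InnerProductSpace ℝ E] (v : OrthonormalBasis ι ℝ E)
    (P : E →L[ℝ] E) {μ : ι → ℝ} (hP : ∀ i, P (v i) = μ i • v i) {c : ℝ} (hc : 0 ≤ c)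
    (hμ : ∀ i, |μ i| ≤ c) (y : E) : ‖P y‖ ≤ c * ‖y‖ := by
  classical
  have hrepr (i : ι) : v.repr (P y) i = μ i * v.repr y i := by
    conv_lhs => rw [← v.sum_repr y]
    simp [hP, Pi.single_apply, mul_comm]
  rw [← abs_of_nonneg (norm_nonneg (P y)), ← abs_of_nonneg (mul_nonneg hc (norm_nonneg y)),
    ← sq_le_sq, mul_pow, ← v.repr.norm_map, ← v.repr.norm_map y, EuclideanSpace.norm_sq_eq,
    EuclideanSpace.norm_sq_eq, Finset.mul_sum]
  refine Finset.sum_le_sum fun i _ => ?_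
  rw [hrepr, norm_mul, mul_pow, Real.norm_eq_abs]
  gcongr
  exact hμ i

/-- The linear part of `t` relaxed steps `x ↦ x + ω s • (f x - x)` at a fixed point. -/
noncomputable def relaxedStepsFDeriv {E : Type*} [NormedAddCommGroup E] [NormedSpace ℝ E]
    (f' : E →L[ℝ] E) (ω : ℕ → ℝ) : ℕ → E →L[ℝ] E
  | 0 => ContinuousLinearMap.id ℝ E
  | t + 1 => (ContinuousLinearMap.id ℝ E + ω t • (f' - ContinuousLinearMap.id ℝ E)) ∘L
      relaxedStepsFDeriv f' ω t

theorem relaxedStepsFDeriv_apply_eigenvector {E : Type*} [NormedAddCommGroup E]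
    [NormedSpace ℝ E] {f' : E →L[ℝ] E} (ω : ℕ → ℝ) {v : E} {μ : ℝ} (hv : v - f' v = μ • v)
    (t : ℕ) :
    relaxedStepsFDeriv f' ω t v = (∏ s ∈ Finset.range t, (1 - ω s * μ)) • v := by
  have hf : f' v = v - μ • v := by rw [← hv]; abel
  induction t with
  | zero => simp [relaxedStepsFDeriv]
  | succ t ih =>
    rw [relaxedStepsFDeriv, ContinuousLinearMap.comp_apply, ih, Finset.prod_range_succ]
    simp only [add_apply, smul_apply, sub_apply, ContinuousLinearMap.id_apply, map_smul, hf]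
    module

open Asymptotics Filter in
theorem isLittleO_relaxedSteps {E : Type*} [NormedAddCommGroup E] [NormedSpace ℝ E]
    {f : E → E} {p : E} (hfix : f p = p) {f' : E →L[ℝ] E} (hdf : HasFDerivAt f f' p)
    {ω : ℕ → ℝ} {T : ℕ} (hT : 1 ≤ T) {x : ℕ → E}
    (hiter : ∀ k, x (k + 1) = x k + ω (k % T) • (f (x k) - x k))
    (hconv : Tendsto x atTop (nhds p)) {t : ℕ} (ht : t ≤ T) :
    (fun l => x (l * T + t) - p - relaxedStepsFDeriv f' ω t (x (l * T) - p)) =o[atTop]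
      fun l => x (l * T) - p := by
  induction t with
  | zero => simp [relaxedStepsFDeriv]
  | succ t ih =>
    have ih := ih (Nat.le_of_succ_le ht)
    have hO : (fun l => x (l * T + t) - p) =O[atTop] fun l => x (l * T) - p := by
      simpa using ih.isBigO.add
        ((relaxedStepsFDeriv f' ω t).isBigO_comp (fun l => x (l * T) - p) atTop)
    have hlim : Tendsto (fun l => x (l * T + t)) atTop (nhds p) :=
      hconv.comp (tendsto_atTop_mono (fun l => (Nat.le_mul_of_pos_right l hT).trans
        (Nat.le_add_right _ t)) tendsto_id)
    have hr := ((hdf.isLittleO.comp_tendsto hlim).trans_isBigO hO).const_smul_left (ω t)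
    have hL := ((ContinuousLinearMap.id ℝ E +
      ω t • (f' - ContinuousLinearMap.id ℝ E)).isBigO_comp _ atTop).trans_isLittleO ih
    refine (hL.add hr).congr_left fun l => ?_
    have hmod : (l * T + t) % T = t := by
      rw [Nat.mul_add_mod_self_right, Nat.mod_eq_of_lt ht]
    rw [← add_assoc, hiter, hmod, relaxedStepsFDeriv]
    simp only [Pi.smul_apply, Function.comp_apply, ContinuousLinearMap.comp_apply, add_apply, smul_apply,
      sub_apply, ContinuousLinearMap.id_apply, map_sub, hfix]
    module

open Asymptotics Filter in
theorem limsup_norm_div_norm_le_of_isLittleO {E : Type*} [NormedAddCommGroup E]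
    {u v w : ℕ → E} {c : ℝ} (h : (fun l => u l - w l) =o[atTop] v)
    (hw : ∀ l, ‖w l‖ ≤ c * ‖v l‖) (hv : ∀ l, v l ≠ 0) :
    limsup (fun l => ‖u l‖ / ‖v l‖) atTop ≤ c := by
  refine le_of_forall_pos_le_add fun ε hε => limsup_le_of_le
    (isCoboundedUnder_le_of_le atTop (x := 0) fun l => by positivity) ?_
  filter_upwards [h.bound hε] with l hl
  rw [div_le_iff₀ (norm_pos_iff.mpr (hv l))]
  linarith [norm_le_norm_add_norm_sub' (u l) (w l), hw l]

/-- Local convergence rate of Chebyshev-PSOR: if `f` is differentiable at its fixed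
point `x*` with Jacobian `J*`, `B = I - J*` is symmetric positive definite with
extreme eigenvalues `0 < a < b`, `κ = b/a`, and the Chebyshev-PSOR iterates
`x^{(k+1)} = x^{(k)} + ω^{ch}_{k mod T}(f(x^{(k)}) - x^{(k)})` converge to `x*`
without ever reaching it, then
`limsup_ℓ ‖x^{((ℓ+1)T)} - x*‖/‖x^{(ℓT)} - x*‖ ≤ sech(T · arcosh((κ+1)/(κ-1)))`. -/
theorem chebyshev_psor_local_rate {n : ℕ}
    (f : EuclideanSpace ℝ (Fin n) → EuclideanSpace ℝ (Fin n))
    (xs : EuclideanSpace ℝ (Fin n)) (hfix : f xs = xs)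
    (f' : EuclideanSpace ℝ (Fin n) →L[ℝ] EuclideanSpace ℝ (Fin n))
    (hdf : HasFDerivAt f f' xs)
    (J B : Matrix (Fin n) (Fin n) ℝ)
    (hJ : Matrix.toEuclideanLin J = (f' : EuclideanSpace ℝ (Fin n) →ₗ[ℝ] EuclideanSpace ℝ (Fin n)))
    (hB : B = 1 - J) (hBH : B.IsHermitian)
    (a b : ℝ) (ha : 0 < a) (hab : a < b)
    (hmin : ∀ i, a ≤ hBH.eigenvalues i) (hmax : ∀ i, hBH.eigenvalues i ≤ b)
    (hminex : ∃ i, hBH.eigenvalues i = a) (hmaxex : ∃ i, hBH.eigenvalues i = b)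
    (κ : ℝ) (hκ : κ = b / a) (T : ℕ) (hT : 1 ≤ T)
    (x : ℕ → EuclideanSpace ℝ (Fin n))
    (hiter : ∀ k, x (k + 1) = x k + chebStep a b T (k % T) • (f (x k) - x k))
    (hconv : Filter.Tendsto x Filter.atTop (nhds xs))
    (hne : ∀ k, x k ≠ xs) :
    Filter.limsup (fun ℓ => ‖x ((ℓ + 1) * T) - xs‖ / ‖x (ℓ * T) - xs‖) Filter.atTop ≤
      (Real.cosh (T * arcosh ((κ + 1) / (κ - 1))))⁻¹ := by
  have hvec (i : Fin n) : hBH.eigenvectorBasis i - f' (hBH.eigenvectorBasis i) =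
      hBH.eigenvalues i • hBH.eigenvectorBasis i := by
    have h := congrArg (WithLp.toLp 2) (hBH.mulVec_eigenvectorBasis i)
    have hJ' := LinearMap.congr_fun hJ (hBH.eigenvectorBasis i)
    rw [ContinuousLinearMap.coe_coe] at hJ'
    rw [← hJ']
    rw [show B.mulVec (hBH.eigenvectorBasis i).ofLp =
      (hBH.eigenvectorBasis i).ofLp - J.mulVec (hBH.eigenvectorBasis i).ofLp by
        simp [hB, Matrix.sub_mulVec]] at h
    simpa [Matrix.toLpLin_apply] using h
  have hlin := isLittleO_relaxedSteps hfix hdf (ω := chebStep a b T) hT hiter hconv le_rfl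
  simp only [Nat.succ_mul]
  refine limsup_norm_div_norm_le_of_isLittleO hlin (fun l => ?_) fun l => sub_ne_zero.mpr (hne _)
  refine hBH.eigenvectorBasis.norm_apply_le_of_forall_eigenvector _
    (fun i => relaxedStepsFDeriv_apply_eigenvector _ (hvec i) T)
    (inv_nonneg.mpr (Real.cosh_pos _).le) (fun i => ?_) _
  rw [hκ]
  exact abs_prod_one_sub_chebStep_mul_le ha hab T (hmin i) (hmax i)
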